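/- arXiv:math/9907047 — 2 statements merged into one kernel-verified Lean document; each statement's English description precedes it below -/
import Mathlib

section
/- Let A, B, C be additive abelian groups, δ : A → B and j : B → C group homomorphisms with the sequence exact at B (the range of δ equals the kernel of j). Let α_A : A → A, α_B : B → B, α_C : C → C be group endomorphisms satisfying α_B ∘ α_B = id, j ∘ α_B = α_C ∘ j, and α_B ∘ δ = δ ∘ α_A. Let N be a natural number and assume that 2^N · (α_A a − a) = 0 for all a ∈ A and 2^N · (α_C c − c) = 0 for all c ∈ C. Then 2^(2N+1) · (α_B x − x) = 0 for every x ∈ B. -/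
/-- Abstract Mayer–Vietoris diagram chase (even-dimensional case): if the sequence
`A --δ--> B --j--> C` is exact at `B`, the endomorphisms `α_A, α_B, α_C` commute with
`δ` and `j`, `α_B` is an involution, and `α_A − id`, `α_C − id` are killed by `2^N`,
then `α_B − id` is killed by `2^(2N+1)`. -/
theorem mayer_vietoris_involution_even
    {A B C : Type*} [AddCommGroup A] [AddCommGroup B] [AddCommGroup C]
    (δ : A →+ B) (j : B →+ C)
    (hexact : ∀ b : B, j b = 0 ↔ ∃ a : A, δ a = b)
    (αA : A →+ A) (αB : B →+ B) (αC : C →+ C)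
    (hinv : ∀ b : B, αB (αB b) = b)
    (hj : ∀ b : B, j (αB b) = αC (j b))
    (hδ : ∀ a : A, αB (δ a) = δ (αA a))
    (N : ℕ)
    (hA : ∀ a : A, 2 ^ N • (αA a - a) = 0)
    (hC : ∀ c : C, 2 ^ N • (αC c - c) = 0) :
    ∀ x : B, 2 ^ (2 * N + 1) • (αB x - x) = 0 := by
  intro x
  obtain ⟨a, ha⟩ := (hexact (2 ^ N • (αB x - x))).1 (by
    rw [map_nsmul, map_sub, hj, hC])
  have hneg : αB (αB x - x) = -(αB x - x) := by
    rw [map_sub, hinv, neg_sub]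
  have hkill : 2 ^ N • (αB (δ a) - δ a) = 0 := by
    rw [hδ, ← map_sub, ← map_nsmul, hA, map_zero]
  rw [ha, map_nsmul, hneg, smul_neg] at hkill
  rw [← neg_eq_zero, ← hkill]
  module
end

section
/- Let A, B, C be additive abelian groups, δ : A → B and j : B → C group homomorphisms with the sequence exact at B (the range of δ equals the kernel of j). Let α_A : A → A, α_B : B → B, α_C : C → C be group endomorphisms satisfying α_B ∘ α_B = id, j ∘ α_B = α_C ∘ j, and α_B ∘ δ = δ ∘ α_A. Let N be a natural number and assume that 2^N · (α_A a + a) = 0 for all a ∈ A and 2^N · (α_C c + c) = 0 for all c ∈ C. Then 2^(2N+1) · (α_B x + x) = 0 for every x ∈ B. -/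
/-- Abstract Mayer–Vietoris diagram chase (odd-dimensional case): if the sequence
`A --δ--> B --j--> C` is exact at `B`, the endomorphisms `α_A, α_B, α_C` commute with
`δ` and `j`, `α_B` is an involution, and `α_A + id`, `α_C + id` are killed by `2^N`,
then `α_B + id` is killed by `2^(2N+1)`. -/
theorem mayer_vietoris_involution_odd
    {A B C : Type*} [AddCommGroup A] [AddCommGroup B] [AddCommGroup C]
    (δ : A →+ B) (j : B →+ C)
    (hexact : ∀ b : B, j b = 0 ↔ ∃ a : A, δ a = b)
    (αA : A →+ A) (αB : B →+ B) (αC : C →+ C)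
    (hinv : ∀ b : B, αB (αB b) = b)
    (hj : ∀ b : B, j (αB b) = αC (j b))
    (hδ : ∀ a : A, αB (δ a) = δ (αA a))
    (N : ℕ)
    (hA : ∀ a : A, 2 ^ N • (αA a + a) = 0)
    (hC : ∀ c : C, 2 ^ N • (αC c + c) = 0) :
    ∀ x : B, 2 ^ (2 * N + 1) • (αB x + x) = 0 := by
  intro x
  obtain ⟨a, ha⟩ := (hexact (2 ^ N • (αB x + x))).1 (by
    rw [map_nsmul, map_add, hj, hC])
  have hfix : αB (δ a) = δ a := by
    rw [ha, map_nsmul, map_add, hinv, add_comm]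
  have hkill : 2 ^ N • (δ a + δ a) = 0 := by
    have h := congrArg δ (hA a)
    rwa [map_nsmul, map_add, ← hδ, hfix, map_zero] at h
  rw [← two_nsmul, ha, ← mul_nsmul', ← mul_nsmul'] at hkill
  convert hkill using 2
  ring
end
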